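/- Assume K satisfies (K1) and f satisfies (f1) and (f2). Let 0<α≤u₀ and let u be a solution of the radial equation on [0,ρ), 0<ρ≤∞, with u(0)=α, u'(0)=0 and u(r)>0 for all r∈[0,ρ). Then |u'(r)|^p/(p'·K(r)) + F(u(r)) ≤ F(α) ≤ 0 for every r ∈ (0,ρ), and it is impossible that lim_{r→ρ} u(r) = 0. In particular a solution starting at or below u₀ can never reach the value 0. -/

import Mathlib

open Set Filter Topology MeasureTheory
open scoped ENNReal NNReal

noncomputable section

/-- `φ_p(s) = |s|^{p-2} s` (with the convention `φ_p(0)=0`). -/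
def phiP (p s : ℝ) : ℝ := |s| ^ (p - 2) * s

/-- `K` is strictly positive and `C¹` on `(0,∞)` and satisfies condition (K1):
the map `r ↦ p + r·K'(r)/K(r)` is strictly positive and decreasing on `(0,∞)`. -/
def CondK1 (p : ℝ) (K : ℝ → ℝ) : Prop :=
  (∀ r : ℝ, 0 < r → 0 < K r) ∧ ContDiffOn ℝ 1 K (Ioi 0) ∧
  (∀ r : ℝ, 0 < r → 0 < p + r * deriv K r / K r) ∧
  AntitoneOn (fun r => p + r * deriv K r / K r) (Ioi 0)

/-- (f1): `f(0)=0`, `f>0` above `u₀`, `f≤0` and not identically `0` on `(0,u₀)`. -/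
def CondF1 (f : ℝ → ℝ) (u₀ : ℝ) : Prop :=
  f 0 = 0 ∧ (∀ v : ℝ, u₀ < v → 0 < f v) ∧ (∀ v ∈ Ioo 0 u₀, f v ≤ 0) ∧
  ∃ v ∈ Ioo 0 u₀, f v ≠ 0

/-- (f2): `f` is continuous on `[0,∞)` and locally Lipschitz on `[u₀,∞)`. -/
def CondF2 (f : ℝ → ℝ) (u₀ : ℝ) : Prop :=
  ContinuousOn f (Ici 0) ∧ LocallyLipschitzOn (Ici u₀) f

/-- `D`: the set of differentiability points of `f` within `[u₀,∞)`. -/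
def Dset (f : ℝ → ℝ) (u₀ : ℝ) : Set ℝ :=
  {v | v ∈ Ici u₀ ∧ DifferentiableWithinAt ℝ f (Ici u₀) v}

/-- the (one-sided) derivative `f'` of `f` on `[u₀,∞)`. -/
def fder (f : ℝ → ℝ) (u₀ : ℝ) (v : ℝ) : ℝ := derivWithin f (Ici u₀) v

/-- (f3): `(p-1)f(u) ≤ f'(u)(u-u₀)` on `D`. -/
def CondF3 (p : ℝ) (f : ℝ → ℝ) (u₀ : ℝ) : Prop :=
  ∀ v ∈ Dset f u₀, (p - 1) * f v ≤ fder f u₀ v * (v - u₀)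

/-- (f4): `u ↦ u·f'(u)/f(u)` is decreasing on `D`. -/
def CondF4 (f : ℝ → ℝ) (u₀ : ℝ) : Prop :=
  AntitoneOn (fun v => v * fder f u₀ v / f v) (Dset f u₀)

/-- `u` is a solution of the radial equation
`(r^{n-1} φ_p(u'))' = -r^{n-1} K(r) f(u)` on the interval `I ⊆ [0,∞)`, `0 ∈ I`:
`u ∈ C¹(I)`, `r ↦ r^{n-1} φ_p(u'(r))` is `C¹` on `I` and the equation holds for `r ∈ I`, `r>0`. -/
def IsRadialSolution (p : ℝ) (n : ℕ) (K f : ℝ → ℝ) (I : Set ℝ) (u : ℝ → ℝ) : Prop :=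
  (0:ℝ) ∈ I ∧ I ⊆ Ici 0 ∧
  ContDiffOn ℝ 1 u I ∧
  ContDiffOn ℝ 1 (fun r => r ^ (n - 1) * phiP p (derivWithin u I r)) I ∧
  ∀ r ∈ I, 0 < r →
    HasDerivWithinAt (fun r => r ^ (n - 1) * phiP p (derivWithin u I r))
      (-(r ^ (n - 1) * K r * f (u r))) I r

/-- `F(s) = ∫₀^s f(t) dt`. -/
def Fint (f : ℝ → ℝ) (s : ℝ) : ℝ := ∫ t in (0:ℝ)..s, f t

theorem abs_phiP {p : ℝ} (hp : 1 < p) (x : ℝ) : |phiP p x| = |x| ^ (p - 1) := by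
  rcases eq_or_ne x 0 with rfl | hx
  · simp [phiP, Real.zero_rpow (sub_pos.2 hp).ne']
  · rw [phiP, abs_mul, abs_of_nonneg (Real.rpow_nonneg (abs_nonneg x) _),
      ← Real.rpow_add_one (abs_ne_zero.2 hx)]
    congr 1
    ring

theorem abs_phiP_rpow {p : ℝ} (hp : 1 < p) (x : ℝ) :
    |phiP p x| ^ (p / (p - 1)) = |x| ^ p := by
  rw [abs_phiP hp, ← Real.rpow_mul (abs_nonneg x), mul_div_cancel₀ _ (sub_pos.2 hp).ne']

theorem phiP_conj_phiP {p : ℝ} (hp : 1 < p) (x : ℝ) :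
    |phiP p x| ^ (p / (p - 1) - 2) * phiP p x = x := by
  rcases eq_or_ne x 0 with rfl | hx
  · simp [phiP]
  · have hx' : 0 < |x| := abs_pos.2 hx
    have hp' : p - 1 ≠ 0 := (sub_pos.2 hp).ne'
    rw [abs_phiP hp, ← Real.rpow_mul hx'.le, phiP, ← mul_assoc, ← Real.rpow_add hx',
      show (p - 1) * (p / (p - 1) - 2) + (p - 2) = 0 by field_simp; ring, Real.rpow_zero, one_mul]

theorem mul_phiP {p : ℝ} (hp : 1 < p) (x : ℝ) : x * phiP p x = |x| ^ p := by
  rcases eq_or_ne x 0 with rfl | hx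
  · simp [phiP, Real.zero_rpow (zero_lt_one.trans hp).ne']
  · rw [phiP, mul_left_comm, ← abs_mul_abs_self x, ← mul_assoc,
      ← Real.rpow_add_one (abs_ne_zero.2 hx), ← Real.rpow_add_one (abs_ne_zero.2 hx)]
    congr 1
    ring

theorem CondF2.intervalIntegrable {f : ℝ → ℝ} {u₀ a b : ℝ} (hf : CondF2 f u₀)
    (ha : 0 ≤ a) (hb : 0 ≤ b) : IntervalIntegrable f volume a b :=
  (hf.1.mono fun _ hx => (le_min ha hb).trans hx.1).intervalIntegrable

theorem CondF2.hasDerivAt_Fint {f : ℝ → ℝ} {u₀ v : ℝ} (hf : CondF2 f u₀) (hv : 0 < v) :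
    HasDerivAt (Fint f) (f v) v :=
  intervalIntegral.integral_hasDerivAt_right (hf.intervalIntegrable le_rfl hv.le)
    ((hf.1.mono Ioi_subset_Ici_self).stronglyMeasurableAtFilter isOpen_Ioi v hv)
    (hf.1.continuousAt (Ici_mem_nhds hv))

theorem antitoneOn_Fint {f : ℝ → ℝ} {u₀ : ℝ} (hf1 : CondF1 f u₀) (hf2 : CondF2 f u₀) :
    AntitoneOn (Fint f) (Icc 0 u₀) := by
  intro a ha b hb hab
  have hle : ∫ t in a..b, f t ≤ ∫ _ in a..b, (0 : ℝ) :=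
    intervalIntegral.integral_mono_on_of_le_Ioo hab (hf2.intervalIntegrable ha.1 hb.1)
      intervalIntegrable_const
      fun x hx => hf1.2.2.1 x ⟨ha.1.trans_lt hx.1, hx.2.trans_le hb.2⟩
  have hadd := intervalIntegral.integral_add_adjacent_intervals
    (hf2.intervalIntegrable le_rfl ha.1) (hf2.intervalIntegrable ha.1 hb.1)
  rw [intervalIntegral.integral_zero] at hle
  simp only [Fint]
  linarith

namespace CondK1

variable {p : ℝ} {K : ℝ → ℝ}

theorem hasDerivAt (hK : CondK1 p K) {r : ℝ} (hr : 0 < r) : HasDerivAt K (deriv K r) r :=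
  ((hK.2.1.differentiableOn (by simp)).differentiableAt (Ioi_mem_nhds hr)).hasDerivAt

theorem neg_mul_lt (hK : CondK1 p K) {r : ℝ} (hr : 0 < r) : -(p * K r) < r * deriv K r := by
  have h := hK.2.2.1 r hr
  have hKr := hK.1 r hr
  have : 0 < (p + r * deriv K r / K r) * K r := mul_pos h hKr
  rw [add_mul, div_mul_cancel₀ _ hKr.ne'] at this
  linarith

theorem tendsto_rpow_mul (hK : CondK1 p K) :
    Tendsto (fun r => r ^ p * K r) (𝓝[>] 0) (𝓝 0) := by
  set c := p + 1 * deriv K 1 / K 1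
  have hc0 : 0 < c := hK.2.2.1 1 one_pos
  have hmono : MonotoneOn (fun r => r ^ (p - c) * K r) (Ioc 0 1) := by
    have hder : ∀ r ∈ Ioc (0 : ℝ) 1, HasDerivAt (fun r => r ^ (p - c) * K r)
        ((p - c) * r ^ (p - c - 1) * K r + r ^ (p - c) * deriv K r) r := fun r hr =>
      (Real.hasDerivAt_rpow_const (Or.inl hr.1.ne')).mul (hK.hasDerivAt hr.1)
    refine monotoneOn_of_deriv_nonneg (convex_Ioc 0 1)
      (fun r hr => (hder r hr).continuousAt.continuousWithinAt)
      (fun r hr => (hder r (interior_subset hr)).differentiableAt.differentiableWithinAt) ?_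
    intro r hr
    have hr := interior_subset hr
    have hKr := hK.1 r hr.1
    have hanti : c ≤ p + r * deriv K r / K r :=
      hK.2.2.2 (mem_Ioi.2 hr.1) (mem_Ioi.2 one_pos) hr.2
    have h1 : 0 ≤ ((p - c) + r * deriv K r / K r) * K r :=
      mul_nonneg (by linarith) hKr.le
    rw [add_mul, div_mul_cancel₀ _ hKr.ne'] at h1
    rw [(hder r hr).deriv]
    have h2 : r ^ (p - c) = r ^ (p - c - 1) * r := by
      rw [← Real.rpow_add_one hr.1.ne']
      congr 1
      ring
    have h3 := mul_nonneg (Real.rpow_nonneg hr.1.le (p - c - 1)) h1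
    rw [h2]
    linarith
  have hlim : Tendsto (fun r : ℝ => r ^ c * K 1) (𝓝[>] 0) (𝓝 0) := by
    have h : Tendsto (fun r : ℝ => r ^ c) (𝓝[>] 0) (𝓝 0) := by
      simpa [Real.zero_rpow hc0.ne'] using
        (Real.continuousAt_rpow_const 0 c (Or.inr hc0.le)).tendsto.mono_left nhdsWithin_le_nhds
    simpa using h.mul_const (K 1)
  refine squeeze_zero' ?_ ?_ hlim
  · filter_upwards [self_mem_nhdsWithin] with r hr
    exact mul_nonneg (Real.rpow_nonneg (le_of_lt hr) _) (hK.1 r hr).le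
  · filter_upwards [Ioc_mem_nhdsGT (zero_lt_one' ℝ)] with r hr
    have h := hmono hr ⟨one_pos, le_rfl⟩ hr.2
    simp only [Real.one_rpow, one_mul] at h
    calc r ^ p * K r = r ^ c * (r ^ (p - c) * K r) := by
          rw [← mul_assoc, ← Real.rpow_add hr.1]
          congr 2
          ring
      _ ≤ r ^ c * K 1 := mul_le_mul_of_nonneg_left h (Real.rpow_nonneg hr.1.le _)

/-- A function vanishing at `0⁺` whose derivative is at most `M r^{n-1} K` is at most
`M r^n K / (n - p)`. -/
theorem le_of_deriv_le (hK : CondK1 p K) {m : ℕ} (hm : p < m + 1)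
    {w w' : ℝ → ℝ} {M δ : ℝ} (hM : 0 ≤ M) (hw0 : Tendsto w (𝓝[>] 0) (𝓝 0))
    (hw : ∀ r ∈ Ioo 0 δ, HasDerivAt w (w' r) r)
    (hw' : ∀ r ∈ Ioo 0 δ, w' r ≤ M * (r ^ m * K r)) {r : ℝ} (hr : r ∈ Ioo 0 δ) :
    w r ≤ M / (m + 1 - p) * (r ^ (m + 1) * K r) := by
  have hmp : (0 : ℝ) < m + 1 - p := by linarith
  set C := M / (m + 1 - p)
  have hC0 : 0 ≤ C := div_nonneg hM hmp.le
  have hCM : C * (m + 1 - p) = M := div_mul_cancel₀ _ hmp.ne'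
  have hder : ∀ s ∈ Ioo 0 δ, HasDerivAt (fun s => w s - C * (s ^ (m + 1) * K s))
      (w' s - C * ((↑(m + 1) * s ^ m) * K s + s ^ (m + 1) * deriv K s)) s := fun s hs =>
    (hw s hs).sub (((hasDerivAt_pow (m + 1) s).mul (hK.hasDerivAt hs.1)).const_mul C)
  have hanti : AntitoneOn (fun s => w s - C * (s ^ (m + 1) * K s)) (Ioo 0 δ) := by
    refine antitoneOn_of_deriv_nonpos (convex_Ioo 0 δ)
      (fun s hs => (hder s hs).continuousAt.continuousWithinAt)
      (fun s hs => (hder s (interior_subset hs)).differentiableAt.differentiableWithinAt) ?_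
    intro s hs
    have hs := interior_subset hs
    rw [(hder s hs).deriv]
    have h1 := hw' s hs
    have h2 : 0 ≤ C * s ^ m * (s * deriv K s + p * K s) :=
      mul_nonneg (mul_nonneg hC0 (pow_nonneg hs.1.le m)) (by linarith [hK.neg_mul_lt hs.1])
    rw [← hCM] at h1
    push_cast
    rw [pow_succ]
    linarith
  have hev : ∀ᶠ s in 𝓝[>] (0 : ℝ), w r - C * (r ^ (m + 1) * K r) ≤ w s := by
    filter_upwards [Ioc_mem_nhdsGT hr.1] with s hs
    have h := hanti ⟨hs.1, hs.2.trans_lt hr.2⟩ hr hs.2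
    have : 0 ≤ C * (s ^ (m + 1) * K s) :=
      mul_nonneg hC0 (mul_nonneg (pow_nonneg hs.1.le _) (hK.1 s hs.1).le)
    simp only at h
    linarith
  linarith [ge_of_tendsto hw0 hev]

end CondK1

/-- The derivative of the energy `|u'|^p / (p' K) + F(u)` along a solution. -/
theorem IsRadialSolution.hasDerivAt_energy {p : ℝ} {m : ℕ} {K f u : ℝ → ℝ} {u₀ : ℝ} {I : Set ℝ}
    (hp : 1 < p) (hK : CondK1 p K) (hf : CondF2 f u₀)
    (hu : IsRadialSolution p (m + 1) K f I u) {r : ℝ} (hr : 0 < r) (hrI : I ∈ 𝓝 r)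
    (hur : 0 < u r) :
    HasDerivAt (fun r => |derivWithin u I r| ^ p / ((p / (p - 1)) * K r) + Fint f (u r))
      (-(|derivWithin u I r| ^ p / ((p / (p - 1)) * K r ^ 2 * r) *
        (m * (p / (p - 1)) * K r + r * deriv K r))) r := by
  have hp1 : 0 < p - 1 := sub_pos.2 hp
  have hp0 : 0 < p := zero_lt_one.trans hp
  have hKr := hK.1 r hr
  set q := p / (p - 1)
  have hq1 : 1 < q := (one_lt_div hp1).2 (by linarith)
  obtain ⟨-, -, hu1, -, heq⟩ := hu
  have hdu : HasDerivAt u (derivWithin u I r) r := by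
    have h := ((hu1.differentiableOn (by simp)).differentiableAt hrI).hasDerivAt
    rwa [← derivWithin_of_mem_nhds hrI] at h
  have hw := (heq r (mem_of_mem_nhds hrI) hr).hasDerivAt hrI
  simp only [Nat.add_sub_cancel] at hw
  have hφ : HasDerivAt (fun s => phiP p (derivWithin u I s))
      (-(K r * f (u r)) - m / r * phiP p (derivWithin u I r)) r := by
    have h := hw.div (hasDerivAt_pow m r) (pow_ne_zero m hr.ne')
    refine (h.congr_deriv ?_).congr_of_eventuallyEq ?_
    · have hpow : (m : ℝ) * r ^ (m - 1) = m / r * r ^ m := by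
        rcases m with _ | k
        · simp
        · rw [Nat.add_sub_cancel, pow_succ]
          field_simp
      rw [hpow]
      have : r ^ m ≠ 0 := pow_ne_zero m hr.ne'
      field_simp
    · filter_upwards [Ioi_mem_nhds hr] with s hs
      exact (mul_div_cancel_left₀ _ (pow_ne_zero m (ne_of_gt hs))).symm
  have habs := (hasDerivAt_abs_rpow (phiP p (derivWithin u I r)) hq1).comp r hφ
  rw [mul_assoc q, phiP_conj_phiP hp] at habs
  have hpw : HasDerivAt (fun s => |derivWithin u I s| ^ p)
      (q * derivWithin u I r * (-(K r * f (u r)) - m / r * phiP p (derivWithin u I r))) r :=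
    habs.congr_of_eventuallyEq (Eventually.of_forall fun s => (abs_phiP_rpow hp _).symm)
  have hE := (hpw.div ((hK.hasDerivAt hr).const_mul q) (by positivity)).add
    ((hf.hasDerivAt_Fint hur).comp r hdu)
  refine hE.congr_deriv ?_
  have hq0 : q ≠ 0 := by positivity
  rw [← mul_phiP hp]
  field_simp
  ring

theorem IsRadialSolution.tendsto_energy {p : ℝ} {m : ℕ} {K f u : ℝ → ℝ} {u₀ : ℝ} {I : Set ℝ}
    (hp : 1 < p) (hmp : p < m + 1) (hK : CondK1 p K) (hf : CondF2 f u₀)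
    (hu : IsRadialSolution p (m + 1) K f I u) (hI0 : I ∈ 𝓝[≥] 0)
    (hI : ∀ r ∈ I, 0 < r → I ∈ 𝓝 r) (hu0 : 0 < u 0) :
    Tendsto (fun r => |derivWithin u I r| ^ p / ((p / (p - 1)) * K r) + Fint f (u r))
      (𝓝[>] 0) (𝓝 (Fint f (u 0))) := by
  have hp1 : 0 < p - 1 := sub_pos.2 hp
  have hp0 : 0 < p := zero_lt_one.trans hp
  have hI0' : I ∈ 𝓝[>] (0 : ℝ) := nhdsWithin_mono 0 Ioi_subset_Ici_self hI0
  obtain ⟨h0I, -, hu1, hw1, heq⟩ := hu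
  simp only [Nat.add_sub_cancel] at hw1 heq
  have hle : 𝓝[>] (0 : ℝ) ≤ 𝓝[I] 0 :=
    le_inf nhdsWithin_le_nhds (le_principal_iff.2 hI0')
  have hulim : Tendsto u (𝓝[>] 0) (𝓝 (u 0)) := (hu1.continuousOn 0 h0I).mono_left hle
  have hm : m ≠ 0 := by
    rintro rfl
    norm_num at hmp
    linarith
  have hwlim : Tendsto (fun r => r ^ m * phiP p (derivWithin u I r)) (𝓝[>] 0) (𝓝 0) := by
    simpa [hm] using (hw1.continuousOn 0 h0I).mono_left hle
  have hwlim' : Tendsto (-fun r => r ^ m * phiP p (derivWithin u I r)) (𝓝[>] 0) (𝓝 0) := by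
    have h := hwlim.neg
    rwa [neg_zero] at h
  set M := |f (u 0)| + 1 with hMdef
  have hM0 : 0 ≤ M := by positivity
  have hfM : ∀ᶠ r in 𝓝[>] (0 : ℝ), |f (u r)| < M :=
    ((hf.1.continuousAt (Ici_mem_nhds hu0)).abs.tendsto.comp hulim).eventually_lt_const
      (by simp [hMdef])
  obtain ⟨δ, hδ, hδI⟩ := mem_nhdsGT_iff_exists_Ioo_subset.1 (inter_mem hI0' hfM)
  have hwd : ∀ r ∈ Ioo 0 δ, HasDerivAt (fun r => r ^ m * phiP p (derivWithin u I r))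
      (-(r ^ m * K r * f (u r))) r := fun r hr =>
    (heq r (hδI hr).1 hr.1).hasDerivAt (hI r (hδI hr).1 hr.1)
  have hbd : ∀ r ∈ Ioo 0 δ, |-(r ^ m * K r * f (u r))| ≤ M * (r ^ m * K r) := by
    intro r hr
    have hpos : 0 ≤ r ^ m * K r := mul_nonneg (pow_nonneg hr.1.le m) (hK.1 r hr.1).le
    rw [abs_neg, abs_mul, abs_of_nonneg hpos, mul_comm]
    exact mul_le_mul_of_nonneg_right (hδI hr).2.le hpos
  set C := M / (m + 1 - p)
  have hC0 : 0 ≤ C := div_nonneg hM0 (by linarith)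
  have hφ : ∀ r ∈ Ioo 0 δ, |phiP p (derivWithin u I r)| ≤ C * (r * K r) := by
    intro r hr
    have h1 := hK.le_of_deriv_le hmp hM0 hwlim hwd (fun s hs => (abs_le.1 (hbd s hs)).2) hr
    have h2 := hK.le_of_deriv_le hmp hM0 hwlim' (fun s hs => (hwd s hs).neg)
      (fun s hs => neg_le.1 (abs_le.1 (hbd s hs)).1) hr
    have hrm : 0 < r ^ m := pow_pos hr.1 m
    simp only [Pi.neg_apply] at h2
    have h3 : |r ^ m * phiP p (derivWithin u I r)| ≤ C * (r ^ (m + 1) * K r) :=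
      abs_le.2 ⟨by linarith, h1⟩
    rw [abs_mul, abs_of_pos hrm, pow_succ,
      show C * (r ^ m * r * K r) = r ^ m * (C * (r * K r)) by ring] at h3
    exact le_of_mul_le_mul_left h3 hrm
  have hkin : Tendsto (fun r => |derivWithin u I r| ^ p / ((p / (p - 1)) * K r))
      (𝓝[>] 0) (𝓝 0) := by
    have hlim : Tendsto (fun r => C ^ (p / (p - 1)) / (p / (p - 1)) *
        (r ^ p * K r) ^ (1 / (p - 1))) (𝓝[>] 0) (𝓝 0) := by
      have h := (hK.tendsto_rpow_mul.rpow_const (p := 1 / (p - 1))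
        (Or.inr (by positivity))).const_mul (C ^ (p / (p - 1)) / (p / (p - 1)))
      rwa [Real.zero_rpow (by positivity), mul_zero] at h
    refine squeeze_zero' ?_ ?_ hlim
    · filter_upwards [self_mem_nhdsWithin] with r hr
      have := hK.1 r hr
      positivity
    · filter_upwards [Ioo_mem_nhdsGT hδ] with r hr
      have hr0 := hr.1
      have hKr := hK.1 r hr0
      have h := Real.rpow_le_rpow (abs_nonneg _) (hφ r hr) (div_pos hp0 hp1).le
      rw [abs_phiP_rpow hp, Real.mul_rpow hC0 (by positivity), Real.mul_rpow hr0.le hKr.le] at h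
      have hexp : K r ^ (p / (p - 1)) = K r ^ (1 / (p - 1)) * K r := by
        rw [← Real.rpow_add_one hKr.ne']
        congr 1
        field_simp
        ring
      rw [Real.mul_rpow (by positivity) hKr.le, ← Real.rpow_mul hr0.le, mul_one_div,
        div_le_iff₀ (by positivity)]
      refine h.trans_eq ?_
      rw [hexp]
      field_simp
  simpa using hkin.add
    ((hf.hasDerivAt_Fint hu0).continuousAt.tendsto.comp hulim)

theorem IsRadialSolution.energy_le {p : ℝ} {m : ℕ} {K f u : ℝ → ℝ} {u₀ : ℝ} {I : Set ℝ}
    (hp : 1 < p) (hmp : p < m + 1) (hK : CondK1 p K) (hf : CondF2 f u₀)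
    (hu : IsRadialSolution p (m + 1) K f I u) (hI0 : I ∈ 𝓝[≥] 0) (hIc : I.OrdConnected)
    (hI : ∀ r ∈ I, 0 < r → I ∈ 𝓝 r) (hpos : ∀ r ∈ I, 0 < u r) {r : ℝ} (hrI : r ∈ I)
    (hr : 0 < r) :
    |derivWithin u I r| ^ p / ((p / (p - 1)) * K r) + Fint f (u r) ≤ Fint f (u 0) := by
  have hp1 : 0 < p - 1 := sub_pos.2 hp
  have hp0 : 0 < p := zero_lt_one.trans hp
  have hsub : Ioc 0 r ⊆ I := fun s hs => hIc.out hu.1 hrI ⟨hs.1.le, hs.2⟩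
  have hder := fun s (hs : s ∈ Ioc 0 r) => hu.hasDerivAt_energy hp hK hf hs.1
    (hI s (hsub hs) hs.1) (hpos s (hsub hs))
  have hanti : AntitoneOn
      (fun r => |derivWithin u I r| ^ p / ((p / (p - 1)) * K r) + Fint f (u r)) (Ioc 0 r) := by
    refine antitoneOn_of_deriv_nonpos (convex_Ioc 0 r)
      (fun s hs => (hder s hs).continuousAt.continuousWithinAt)
      (fun s hs => (hder s (interior_subset hs)).differentiableAt.differentiableWithinAt) ?_
    intro s hs
    have hs := interior_subset hs
    have hs0 := hs.1
    have hKs := hK.1 s hs0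
    rw [(hder s hs).deriv, neg_nonpos]
    refine mul_nonneg (by positivity) ?_
    have hpm : p ≤ m * (p / (p - 1)) := by
      rw [mul_div_assoc', le_div_iff₀ hp1, mul_comm]
      exact mul_le_mul_of_nonneg_right (by linarith) hp0.le
    linarith [hK.neg_mul_lt hs0, mul_le_mul_of_nonneg_right hpm hKs.le]
  refine ge_of_tendsto (hu.tendsto_energy hp hmp hK hf hI0 hI (hpos 0 hu.1)) ?_
  filter_upwards [Ioc_mem_nhdsGT hr] with s hs
  exact hanti hs ⟨hr, le_rfl⟩ hs.2

/-- A solution starting in `(0, u₀]` stays above its initial value. -/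
theorem IsRadialSolution.initial_le {p : ℝ} {m : ℕ} {K f u : ℝ → ℝ} {u₀ : ℝ} {I : Set ℝ}
    (hp : 1 < p) (hmp : p < m + 1) (hK : CondK1 p K) (hf1 : CondF1 f u₀) (hf2 : CondF2 f u₀)
    (hu : IsRadialSolution p (m + 1) K f I u) (hI0 : I ∈ 𝓝[≥] 0) (hIc : I.OrdConnected)
    (hI : ∀ r ∈ I, 0 < r → I ∈ 𝓝 r) (hpos : ∀ r ∈ I, 0 < u r) (hu0 : u 0 ≤ u₀)
    {r : ℝ} (hrI : r ∈ I) : u 0 ≤ u r := by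
  have hp1 : 0 < p - 1 := sub_pos.2 hp
  have hp0 : 0 < p := zero_lt_one.trans hp
  by_contra! hlt
  have hr0 : 0 ≤ r := hu.2.1 hrI
  have hsub : Icc 0 r ⊆ I := hIc.out hu.1 hrI
  have hcont : ContinuousOn u (Icc 0 r) := hu.2.2.1.continuousOn.mono hsub
  have hcomp : IsCompact (Icc 0 r ∩ u ⁻¹' Ici (u 0)) :=
    isCompact_Icc.of_isClosed_subset (hcont.preimage_isClosed_of_isClosed isClosed_Icc isClosed_Ici)
      inter_subset_left
  obtain ⟨s, ⟨hs, hus⟩, hmax⟩ := hcomp.exists_isGreatest ⟨0, ⟨le_rfl, hr0⟩, le_refl (u 0)⟩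
  have hus : u 0 ≤ u s := hus
  have hsr : s < r := hs.2.lt_of_ne fun h => by
    rw [h] at hus
    linarith
  have hdu : ∀ x ∈ Ioo s r, HasDerivAt u (derivWithin u I x) x := fun x hx => by
    have hxI : I ∈ 𝓝 x := hI x (hsub ⟨hs.1.trans hx.1.le, hx.2.le⟩) (hs.1.trans_lt hx.1)
    rw [derivWithin_of_mem_nhds hxI]
    exact ((hu.2.2.1.differentiableOn (by simp)).differentiableAt hxI).hasDerivAt
  obtain ⟨c, hc, hslope⟩ := exists_hasDerivAt_eq_slope u _ hsr
    (hcont.mono (Icc_subset_Icc_left hs.1)) hdu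
  have hc0 : 0 < c := hs.1.trans_lt hc.1
  have hcI : c ∈ I := hsub ⟨hc0.le, hc.2.le⟩
  have huc : u c < u 0 := by
    by_contra! h
    exact (hmax ⟨⟨hc0.le, hc.2.le⟩, h⟩).not_gt hc.1
  have hE := hu.energy_le hp hmp hK hf2 hI0 hIc hI hpos hcI hc0
  have hF := antitoneOn_Fint hf1 hf2 ⟨(hpos c hcI).le, huc.le.trans hu0⟩
    ⟨(hpos 0 hu.1).le, hu0⟩ huc.le
  have hneg : derivWithin u I c < 0 := by
    rw [hslope]
    exact div_neg_of_neg_of_pos (by linarith) (by linarith)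
  have hKc := hK.1 c hc0
  have habs : 0 < |derivWithin u I c| := abs_pos.2 hneg.ne
  have : 0 < |derivWithin u I c| ^ p / ((p / (p - 1)) * K c) := by positivity
  linarith

/-- A solution starting at or below `u₀` has nonpositive energy and can never
reach the value `0`. -/
theorem no_crossing_below_u0
    (p : ℝ) (n : ℕ) (hp : 1 < p) (hn : p < n)
    (K f : ℝ → ℝ) (u₀ : ℝ) (hu₀ : 0 < u₀)
    (hK : CondK1 p K) (hf1 : CondF1 f u₀) (hf2 : CondF2 f u₀)
    (α : ℝ) (hα : 0 < α) (hαu₀ : α ≤ u₀)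
    (I : Set ℝ) (hI : I = Ici 0 ∨ ∃ ρ : ℝ, 0 < ρ ∧ I = Ico 0 ρ)
    (u : ℝ → ℝ) (hu : IsRadialSolution p n K f I u)
    (hu0 : u 0 = α) (hu'0 : derivWithin u I 0 = 0)
    (hpos : ∀ r ∈ I, 0 < u r) :
    (∀ r ∈ I, 0 < r →
      |derivWithin u I r| ^ p / ((p / (p - 1)) * K r) + Fint f (u r) ≤ Fint f α) ∧
    Fint f α ≤ 0 ∧
    (I = Ici 0 → ¬ Tendsto u atTop (𝓝 0)) ∧
    (∀ ρ : ℝ, 0 < ρ → I = Ico 0 ρ → ¬ Tendsto u (𝓝[<] ρ) (𝓝 0)) := by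
  obtain ⟨m, rfl⟩ : ∃ m, n = m + 1 := Nat.exists_eq_succ_of_ne_zero fun h => by
    rw [h, Nat.cast_zero] at hn
    linarith
  push_cast at hn
  subst hu0
  have hI0 : I ∈ 𝓝[≥] 0 := by
    rcases hI with rfl | ⟨ρ, hρ, rfl⟩
    · exact self_mem_nhdsWithin
    · exact Ico_mem_nhdsGE hρ
  have hIc : I.OrdConnected := by
    rcases hI with rfl | ⟨ρ, hρ, rfl⟩
    · exact ordConnected_Ici
    · exact ordConnected_Ico
  have hIn : ∀ r ∈ I, 0 < r → I ∈ 𝓝 r := by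
    rcases hI with rfl | ⟨ρ, hρ, rfl⟩
    · exact fun r _ hr => Ici_mem_nhds hr
    · exact fun r hrI hr => Ico_mem_nhds hr hrI.2
  have hle : ∀ r ∈ I, u 0 ≤ u r := fun r hrI =>
    hu.initial_le hp hn hK hf1 hf2 hI0 hIc hIn hpos hαu₀ hrI
  refine ⟨fun r hrI hr => hu.energy_le hp hn hK hf2 hI0 hIc hIn hpos hrI hr, ?_, ?_, ?_⟩
  · simpa [Fint] using antitoneOn_Fint hf1 hf2 ⟨le_rfl, hu₀.le⟩ ⟨hα.le, hαu₀⟩ hα.le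
  · rintro rfl hlim
    refine hα.not_ge (ge_of_tendsto hlim ?_)
    filter_upwards [Ici_mem_atTop (0 : ℝ)] with r hr using hle r hr
  · rintro ρ hρ rfl hlim
    refine hα.not_ge (ge_of_tendsto hlim ?_)
    filter_upwards [Ico_mem_nhdsLT hρ] with r hr using hle r hr
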